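/- If ν is a real number with |ν| ≤ 1/2, then the Struve function of the first kind satisfies H_ν(x) > 0 for all x ∈ (0, 1]; in other words, the smallest positive zero of H_ν is greater than 1. -/

import Mathlib

noncomputable section

/-- The Struve function of the first kind
`H_ν(x) = ∑ (−1)^n (x/2)^(2n+ν+1) / (Γ(n+3/2) Γ(ν+n+3/2))` for real `x > 0`. -/
def struveFun (ν : ℝ) (x : ℝ) : ℝ :=
  ∑' n : ℕ, (-1 : ℝ) ^ n * (x / 2) ^ (2 * (n : ℝ) + ν + 1) /
    (Real.Gamma ((n : ℝ) + 3 / 2) * Real.Gamma (ν + n + 3 / 2))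

/-- The absolute value of the `n`-th term of the Struve series. -/
def struveTerm (ν x : ℝ) (n : ℕ) : ℝ :=
  (x / 2) ^ (2 * (n : ℝ) + ν + 1) /
    (Real.Gamma ((n : ℝ) + 3 / 2) * Real.Gamma (ν + n + 3 / 2))

theorem struveTerm_pos {ν x : ℝ} (hν : -3 / 2 < ν) (hx : 0 < x) (n : ℕ) :
    0 < struveTerm ν x n := by
  have hn : (0 : ℝ) ≤ n := n.cast_nonneg
  have h₁ : 0 < Real.Gamma ((n : ℝ) + 3 / 2) := Real.Gamma_pos_of_pos (by linarith)
  have h₂ : 0 < Real.Gamma (ν + n + 3 / 2) := Real.Gamma_pos_of_pos (by linarith)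
  unfold struveTerm
  positivity

theorem struveTerm_succ {ν x : ℝ} (hν : -3 / 2 < ν) (hx : 0 < x) (n : ℕ) :
    struveTerm ν x (n + 1) =
      (x / 2) ^ 2 / (((n : ℝ) + 3 / 2) * (ν + n + 3 / 2)) * struveTerm ν x n := by
  have hn : (0 : ℝ) ≤ n := n.cast_nonneg
  have hpow : (x / 2) ^ (2 * ((n + 1 : ℕ) : ℝ) + ν + 1) =
      (x / 2) ^ (2 * (n : ℝ) + ν + 1) * (x / 2) ^ 2 := by
    rw [← Real.rpow_natCast, ← Real.rpow_add (by positivity)]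
    congr 1
    push_cast
    ring
  have hΓ₁ : Real.Gamma (((n + 1 : ℕ) : ℝ) + 3 / 2) =
      ((n : ℝ) + 3 / 2) * Real.Gamma ((n : ℝ) + 3 / 2) := by
    rw [← Real.Gamma_add_one (by linarith)]
    congr 1
    push_cast
    ring
  have hΓ₂ : Real.Gamma (ν + (n + 1 : ℕ) + 3 / 2) =
      (ν + n + 3 / 2) * Real.Gamma (ν + n + 3 / 2) := by
    rw [← Real.Gamma_add_one (by linarith)]
    congr 1
    push_cast
    ring
  rw [struveTerm, hpow, hΓ₁, hΓ₂, struveTerm, div_mul_div_comm]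
  congr 1 <;> ring

theorem struveTerm_succ_le {ν x : ℝ} (hν : -1 / 2 ≤ ν) (hx₀ : 0 < x) (hx₁ : x ≤ 1) (n : ℕ) :
    struveTerm ν x (n + 1) ≤ 1 / 6 * struveTerm ν x n := by
  have hn : (0 : ℝ) ≤ n := n.cast_nonneg
  rw [struveTerm_succ (by linarith) hx₀]
  refine mul_le_mul_of_nonneg_right ?_ (struveTerm_pos (by linarith) hx₀ n).le
  have hden : 3 / 2 * 1 ≤ ((n : ℝ) + 3 / 2) * (ν + n + 3 / 2) :=
    mul_le_mul (by linarith) (by linarith) zero_le_one (by linarith)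
  rw [div_le_iff₀ (by linarith)]
  nlinarith

/-- If `|ν| ≤ 1/2`, then `H_ν(x) > 0` for all `x ∈ (0, 1]`; in other words, the smallest
positive zero of `H_ν` is greater than `1`. -/
theorem struveFun_pos (ν : ℝ) (hν : |ν| ≤ 1 / 2) (x : ℝ) (hx₀ : 0 < x) (hx₁ : x ≤ 1) :
    0 < struveFun ν x := by
  have hν' : -1 / 2 ≤ ν := by linarith [neg_le_of_abs_le hν]
  have hpos := struveTerm_pos (show -3 / 2 < ν by linarith) hx₀
  have hle := struveTerm_succ_le hν' hx₀ hx₁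
  have hanti : Antitone (struveTerm ν x) :=
    antitone_nat_of_succ_le fun n => by linarith [hle n, hpos n]
  have hsum : Summable fun n : ℕ => (-1 : ℝ) ^ n * struveTerm ν x n := by
    refine summable_of_ratio_norm_eventually_le (r := 1 / 6) (by norm_num) (.of_forall fun n => ?_)
    simpa [abs_of_pos (hpos _)] using hle n
  have hfun : struveFun ν x = ∑' n : ℕ, (-1 : ℝ) ^ n * struveTerm ν x n := by
    simp only [struveFun, struveTerm, mul_div_assoc]
  have hpartial := hanti.alternating_series_le_tendsto hsum.hasSum.tendsto_sum_nat 1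
  rw [← hfun] at hpartial
  norm_num [Finset.sum_range_succ] at hpartial
  linarith [hle 0, hpos 0]
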